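/- arXiv:2603.25838 — 3 statements merged into one kernel-verified Lean document; each statement's English description precedes it below -/
import Mathlib

section
/- Let A, A′ ∈ ℝ^{p×p} be strictly lower triangular under permutations σ and σ′ respectively, and set B = (I − A)^{-1}, B′ = (I − A′)^{-1}. Suppose that for every ℓ ∈ {1,…,p} there exist nonzero scalars α_ℓ, α′_ℓ ∈ ℝ such that α_ℓ B e_ℓ = α′_ℓ B′ e_ℓ. Then α_ℓ = α′_ℓ for all ℓ, B = B′, and A = A′. (Population-level identifiability of the causal coefficient matrix from one-sparse mean-shift interventions targeting every node.) -/
open Matrix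

theorem det_aux (p : ℕ) (A : Matrix (Fin p) (Fin p) ℝ) (σ : Equiv.Perm (Fin p))
    (h : ∀ i j : Fin p, i ≤ j → A (σ i) (σ j) = 0) : (1 - A).det = 1 := by
  rw [← Matrix.det_submatrix_equiv_self σ, Matrix.det_of_lowerTriangular]
  · apply Finset.prod_eq_one
    intro i _
    simp [h i i le_rfl]
  · intro i j hij
    have hij' : i < j := hij
    simp [h i j hij'.le, Matrix.one_apply, hij'.ne]

theorem diag_aux (p : ℕ) (A : Matrix (Fin p) (Fin p) ℝ) (σ : Equiv.Perm (Fin p))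
    (h : ∀ i j : Fin p, i ≤ j → A (σ i) (σ j) = 0) (l : Fin p) : A l l = 0 := by
  simpa using h (σ.symm l) (σ.symm l) le_rfl

/-- Population-level identifiability: if two latent linear DAG models (each strictly
lower triangular under some permutation) generate identical mean contrasts
`α_ℓ B e_ℓ = α'_ℓ B' e_ℓ` from nonzero one-sparse mean-shift interventions at every
node `ℓ`, then `α = α'`, `B = B'` and `A = A'`. -/
theorem mean_shift_identifiability
    (p : ℕ) (A A' : Matrix (Fin p) (Fin p) ℝ)
    (σ σ' : Equiv.Perm (Fin p))
    (h : ∀ i j : Fin p, i ≤ j → A (σ i) (σ j) = 0)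
    (h' : ∀ i j : Fin p, i ≤ j → A' (σ' i) (σ' j) = 0)
    (B B' : Matrix (Fin p) (Fin p) ℝ)
    (hB : B = (1 - A)⁻¹) (hB' : B' = (1 - A')⁻¹)
    (α α' : Fin p → ℝ) (hα : ∀ ℓ, α ℓ ≠ 0) (hα' : ∀ ℓ, α' ℓ ≠ 0)
    (heq : ∀ ℓ : Fin p, α ℓ • B.mulVec (Pi.single ℓ 1) = α' ℓ • B'.mulVec (Pi.single ℓ 1)) :
    (∀ ℓ, α ℓ = α' ℓ) ∧ B = B' ∧ A = A' := by
  have u : IsUnit (1 - A).det := by rw [det_aux p A σ h]; exact isUnit_one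
  have u' : IsUnit (1 - A').det := by rw [det_aux p A' σ' h']; exact isUnit_one
  have hX : B * diagonal α = B' * diagonal α' := by
    ext i j
    have := congrFun (heq j) i
    simp at this
    simp [Matrix.mul_diagonal]
    linarith
  have e1 : (diagonal (fun i => (α i)⁻¹) * (1 - A)) * (B * diagonal α) = 1 := by
    rw [Matrix.mul_assoc, ← Matrix.mul_assoc (1 - A), hB, Matrix.mul_nonsing_inv _ u,
      Matrix.one_mul, Matrix.diagonal_mul_diagonal]
    simp [hα]
  have e2 : (diagonal (fun i => (α' i)⁻¹) * (1 - A')) * (B' * diagonal α') = 1 := by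
    rw [Matrix.mul_assoc, ← Matrix.mul_assoc (1 - A'), hB', Matrix.mul_nonsing_inv _ u',
      Matrix.one_mul, Matrix.diagonal_mul_diagonal]
    simp [hα']
  rw [← hX] at e2
  have e3 := left_inv_eq_right_inv e1 (mul_eq_one_comm.mp e2)
  have hαα : ∀ l, α l = α' l := by
    intro l
    have := congrFun (congrFun e3 l) l
    simpa [Matrix.diagonal_mul, diag_aux p A σ h, diag_aux p A' σ' h'] using this
  have hA : A = A' := by
    ext i j
    have := congrFun (congrFun e3 i) j
    rw [Matrix.diagonal_mul, Matrix.diagonal_mul, ← hαα i] at this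
    have := mul_left_cancel₀ (inv_ne_zero (hα i)) this
    simpa using this
  exact ⟨hαα, by rw [hB, hB', hA], hA⟩
end

section
/- Let A*, Â, B̂ ∈ ℝ^{p×p}, suppose I − A* is invertible with B* = (I − A*)^{-1}. Assume: (i) max_i Σ_k |(I − A*)_{ik}| ≤ M (maximum absolute row sum of I − A* bounded by M); (ii) ‖B̂ − B*‖_max ≤ δ; (iii) ‖B̂(I − Â) − I‖_max ≤ λ; and (iv) ‖I − Â‖_{L1} ≤ M′. Then ‖Â − A*‖_max ≤ M(δM′ + λ). -/
open Matrix

/-- Elementwise maximum norm `‖M‖_max = max_{i,j} |M i j|`. -/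
noncomputable def maxNorm {p : ℕ} (M : Matrix (Fin p) (Fin p) ℝ) : ℝ :=
  ⨆ i, ⨆ j, |M i j|

/-- Maximum absolute row sum `max_i ∑_k |M i k|`. -/
noncomputable def maxRowSum {p : ℕ} (M : Matrix (Fin p) (Fin p) ℝ) : ℝ :=
  ⨆ i, ∑ k, |M i k|

/-- Matrix `L1` norm: maximum absolute column sum `max_j ∑_i |M i j|`. -/
noncomputable def l1OpNorm {p : ℕ} (M : Matrix (Fin p) (Fin p) ℝ) : ℝ :=
  ⨆ j, ∑ i, |M i j|

/-- Deterministic entrywise error bound for the CLIME-type estimator: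
if the max row sum of `I - A*` is at most `M`, `‖B̂ - B*‖_max ≤ δ`,
`‖B̂(I - Â) - I‖_max ≤ λ` and `‖I - Â‖_{L1} ≤ M'`, then
`‖Â - A*‖_max ≤ M (δ M' + λ)`. -/
theorem clime_entrywise_error_bound
    (p : ℕ) (Astar Ahat Bhat : Matrix (Fin p) (Fin p) ℝ)
    (hinv : IsUnit (1 - Astar))
    (Bstar : Matrix (Fin p) (Fin p) ℝ) (hB : Bstar = (1 - Astar)⁻¹)
    (M δ lam M' : ℝ)
    (h1 : maxRowSum (1 - Astar) ≤ M)
    (h2 : maxNorm (Bhat - Bstar) ≤ δ)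
    (h3 : maxNorm (Bhat * (1 - Ahat) - 1) ≤ lam)
    (h4 : l1OpNorm (1 - Ahat) ≤ M') :
    maxNorm (Ahat - Astar) ≤ M * (δ * M' + lam) := by
  have n1 : 0 ≤ M := le_trans (Real.iSup_nonneg fun i => Finset.sum_nonneg fun k _ => abs_nonneg _) h1
  have n2 : 0 ≤ δ := le_trans (Real.iSup_nonneg fun i => Real.iSup_nonneg fun k => abs_nonneg _) h2
  have n3 : 0 ≤ lam := le_trans (Real.iSup_nonneg fun i => Real.iSup_nonneg fun k => abs_nonneg _) h3
  have n4 : 0 ≤ M' := le_trans (Real.iSup_nonneg fun i => Finset.sum_nonneg fun k _ => abs_nonneg _) h4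
  have e1 : ∀ i, ∑ k, |(1 - Astar) i k| ≤ M := fun i =>
    (le_ciSup (f := fun i => ∑ k, |(1 - Astar) i k|) (Set.finite_range _).bddAbove i).trans h1
  have e4 : ∀ j, ∑ k, |(1 - Ahat) k j| ≤ M' := fun j =>
    (le_ciSup (f := fun j => ∑ k, |(1 - Ahat) k j|) (Set.finite_range _).bddAbove j).trans h4
  have emax : ∀ (X : Matrix (Fin p) (Fin p) ℝ) i j, |X i j| ≤ maxNorm X := fun X i j =>
    (le_ciSup (f := fun j => |X i j|) (Set.finite_range _).bddAbove j).trans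
      (le_ciSup (f := fun i => ⨆ j, |X i j|) (Set.finite_range _).bddAbove i)
  have hI : (1 - Astar) * Bstar = 1 := by
    rw [hB]
    exact Matrix.mul_nonsing_inv _ ((Matrix.isUnit_iff_isUnit_det _).1 hinv)
  have key : Ahat - Astar = (1 - Astar) *
      ((Bhat - Bstar) * (1 - Ahat) - (Bhat * (1 - Ahat) - 1)) := by
    have h : (Bhat - Bstar) * (1 - Ahat) - (Bhat * (1 - Ahat) - 1)
        = 1 - Bstar * (1 - Ahat) := by
      rw [sub_mul]; abel
    rw [h, mul_sub, ← mul_assoc, hI, mul_one, one_mul]; abel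
  have hb : ∀ i j, |((Bhat - Bstar) * (1 - Ahat) - (Bhat * (1 - Ahat) - 1)) i j|
      ≤ δ * M' + lam := by
    intro i j
    rw [Matrix.sub_apply]
    refine (abs_sub _ _).trans (add_le_add ?_ ((emax _ i j).trans h3))
    rw [Matrix.mul_apply]
    calc |∑ k, (Bhat - Bstar) i k * (1 - Ahat) k j|
        ≤ ∑ k, |(Bhat - Bstar) i k * (1 - Ahat) k j| := Finset.abs_sum_le_sum_abs _ _
      _ ≤ ∑ k, δ * |(1 - Ahat) k j| := Finset.sum_le_sum fun k _ => by
          rw [abs_mul]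
          exact mul_le_mul_of_nonneg_right ((emax _ i k).trans h2) (abs_nonneg _)
      _ = δ * ∑ k, |(1 - Ahat) k j| := (Finset.mul_sum _ _ _).symm
      _ ≤ δ * M' := mul_le_mul_of_nonneg_left (e4 j) n2
  have n5 : 0 ≤ δ * M' + lam := by positivity
  have n6 : 0 ≤ M * (δ * M' + lam) := mul_nonneg n1 n5
  rw [key]
  refine Real.iSup_le (fun i => Real.iSup_le (fun j => ?_) n6) n6
  generalize (Bhat - Bstar) * (1 - Ahat) - (Bhat * (1 - Ahat) - 1) = X at hb
  rw [Matrix.mul_apply]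
  calc |∑ k, (1 - Astar) i k * X k j|
      ≤ ∑ k, |(1 - Astar) i k * X k j| := Finset.abs_sum_le_sum_abs _ _
    _ ≤ ∑ k, |(1 - Astar) i k| * (δ * M' + lam) := Finset.sum_le_sum fun k _ => by
        rw [abs_mul]
        exact mul_le_mul_of_nonneg_left (hb k j) (abs_nonneg _)
    _ = (∑ k, |(1 - Astar) i k|) * (δ * M' + lam) := (Finset.sum_mul _ _ _).symm
    _ ≤ M * (δ * M' + lam) := mul_le_mul_of_nonneg_right (e1 i) n5
end

section
/- Let A* ∈ ℝ^{p×p} with I − A* invertible, B* = (I − A*)^{-1}, and τ > 0. Suppose every nonzero entry of A* satisfies |A*_{ij}| ≥ 2τ (beta-min condition) and max_i Σ_k |(I − A*)_{ik}| ≤ M. Then for every matrix A ∈ ℝ^{p×p} whose thresholded graph differs from the true graph, G(A_τ) ≠ G(A*), one has ‖A − A*‖_max ≥ τ and consequently ‖B*(I − A) − I‖_max ≥ τ/M. In particular, the degree of reconstructability ζ(A*) = inf{‖B*(I − A) − I‖_max : G(A_τ) ≠ G(A*)} is at least τ/M. -/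
open Matrix

/-- Hard thresholding: `(A_τ)_{ij} = A_{ij} 1{|A_{ij}| ≥ τ}`. -/
noncomputable def hardThreshold {p : ℕ} (A : Matrix (Fin p) (Fin p) ℝ) (τ : ℝ) :
    Matrix (Fin p) (Fin p) ℝ :=
  Matrix.of fun i j => if τ ≤ |A i j| then A i j else 0

/-- Two matrices induce the same directed graph `G(A) = ([p], {(i,j) : A_{ji} ≠ 0})`
iff their supports coincide. -/
def sameGraph {p : ℕ} (A B : Matrix (Fin p) (Fin p) ℝ) : Prop :=
  ∀ i j, A i j ≠ 0 ↔ B i j ≠ 0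

lemma aux_le_maxNorm {p : ℕ} (M : Matrix (Fin p) (Fin p) ℝ) (i j : Fin p) :
    |M i j| ≤ maxNorm M := by
  unfold maxNorm
  have h1 : |M i j| ≤ ⨆ j, |M i j| :=
    le_ciSup (f := fun j => |M i j|) (Set.finite_range _).bddAbove j
  have h2 : (⨆ j, |M i j|) ≤ ⨆ i, ⨆ j, |M i j| :=
    le_ciSup (f := fun i => ⨆ j, |M i j|) (Set.finite_range _).bddAbove i
  exact h1.trans h2

lemma aux_row_le {p : ℕ} (M : Matrix (Fin p) (Fin p) ℝ) (i : Fin p) :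
    ∑ k, |M i k| ≤ maxRowSum M :=
  le_ciSup (f := fun i => ∑ k, |M i k|) (Set.finite_range _).bddAbove i

/-- Under the beta-min condition, any matrix `A` whose thresholded graph differs
from the true graph satisfies `‖A - A*‖_max ≥ τ` and hence
`‖B*(I - A) - I‖_max ≥ τ/M`; in particular the degree of reconstructability
`ζ(A*)` is at least `τ/M`. -/
theorem betamin_lower_bounds_reconstructability
    (p : ℕ) (hp : 1 ≤ p)
    (Astar : Matrix (Fin p) (Fin p) ℝ) (hinv : IsUnit (1 - Astar))
    (Bstar : Matrix (Fin p) (Fin p) ℝ) (hB : Bstar = (1 - Astar)⁻¹)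
    (τ M : ℝ) (hτ : 0 < τ)
    (hbetamin : ∀ i j, Astar i j ≠ 0 → 2 * τ ≤ |Astar i j|)
    (hM : maxRowSum (1 - Astar) ≤ M) :
    (∀ A : Matrix (Fin p) (Fin p) ℝ, ¬ sameGraph (hardThreshold A τ) Astar →
      τ ≤ maxNorm (A - Astar) ∧ τ / M ≤ maxNorm (Bstar * (1 - A) - 1)) ∧
    τ / M ≤ sInf {x : ℝ | ∃ A : Matrix (Fin p) (Fin p) ℝ,
      ¬ sameGraph (hardThreshold A τ) Astar ∧ x = maxNorm (Bstar * (1 - A) - 1)} := by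
  have key : ∀ A : Matrix (Fin p) (Fin p) ℝ, ¬ sameGraph (hardThreshold A τ) Astar →
      τ ≤ maxNorm (A - Astar) ∧ τ / M ≤ maxNorm (Bstar * (1 - A) - 1) := by
    intro A hA
    have hex : ∃ i j, τ ≤ |(A - Astar) i j| := by
      by_contra! hcon
      apply hA
      intro i j
      have hd := hcon i j
      rw [Matrix.sub_apply] at hd
      simp only [hardThreshold, Matrix.of_apply]
      constructor
      · intro h h0
        rw [h0, sub_zero] at hd
        rw [if_neg (not_le.mpr hd)] at h
        exact h rfl
      · intro h
        have hb := hbetamin i j h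
        have h3 : |Astar i j| - |A i j| ≤ |A i j - Astar i j| := by
          rw [abs_sub_comm]
          exact abs_sub_abs_le_abs_sub _ _
        have h4 : τ ≤ |A i j| := by linarith
        rw [if_pos h4]
        exact abs_pos.mp (by linarith)
    obtain ⟨i, j, hij⟩ := hex
    refine ⟨hij.trans (aux_le_maxNorm _ i j), ?_⟩
    set X := Bstar * (1 - A) - 1 with hX
    have hX0 : 0 ≤ maxNorm X := (abs_nonneg _).trans (aux_le_maxNorm X i j)
    have hrow : ∑ k, |(1 - Astar) i k| ≤ M := (aux_row_le _ i).trans hM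
    have hM0 : 0 ≤ M := (Finset.sum_nonneg fun k _ => abs_nonneg _).trans hrow
    have hid : (1 - Astar) * X = Astar - A := by
      have hu : (1 - Astar) * Bstar = 1 := by
        rw [hB]
        exact Matrix.mul_nonsing_inv _ ((Matrix.isUnit_iff_isUnit_det _).mp hinv)
      rw [hX, mul_sub, ← mul_assoc, hu, one_mul, mul_one]
      abel
    have hb : |(A - Astar) i j| ≤ M * maxNorm X := by
      have e : (A - Astar) i j = -((1 - Astar) * X) i j := by
        rw [hid]; simp
      rw [e, abs_neg, Matrix.mul_apply]
      calc |∑ k, (1 - Astar) i k * X k j| ≤ ∑ k, |(1 - Astar) i k * X k j| :=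
            Finset.abs_sum_le_sum_abs _ _
        _ ≤ ∑ k, |(1 - Astar) i k| * maxNorm X := by
            apply Finset.sum_le_sum
            intro k _
            rw [abs_mul]
            exact mul_le_mul_of_nonneg_left (aux_le_maxNorm X k j) (abs_nonneg _)
        _ = (∑ k, |(1 - Astar) i k|) * maxNorm X := by rw [Finset.sum_mul]
        _ ≤ M * maxNorm X := mul_le_mul_of_nonneg_right hrow hX0
    exact div_le_of_le_mul₀ hM0 hX0 (by linarith)
  refine ⟨key, le_csInf ?_ ?_⟩
  · let i : Fin p := ⟨0, hp⟩
    by_cases h : Astar i i = 0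
    · refine ⟨_, Matrix.of fun _ _ => τ, ?_, rfl⟩
      intro hs
      have := (hs i i).mp (by simp [hardThreshold, le_abs_self, hτ.ne'])
      exact this h
    · refine ⟨_, 0, ?_, rfl⟩
      intro hs
      have := (hs i i).mpr h
      simp [hardThreshold] at this
  · rintro x ⟨A, hA, rfl⟩
    exact (key A hA).2
end
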